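/- arXiv:1009.1510 — 3 statements merged into one kernel-verified Lean document; each statement's English description precedes it below -/
import Mathlib

section
/- Let λ be a positive measure on {|x| ≥ R} with density p(x) = ∑_{n≥2} aₙ/xⁿ converging absolutely for |x| > r (0 < r < R), nonnegative on |x| ≥ R. Then the Fourier transform F_λ(z) = ∫_{|x|>R} e^{ixz} p(x) dx defined for z > 0 equals the restriction of the entire function z ↦ ∫_{C_R} e^{iz/u} p(1/u) u^{-2} du, where C_R = {R^{-1}e^{iθ} : -π ≤ θ ≤ 0}. -/
open MeasureTheory Complex

/-- Condition (A2): the density `p` has the form `p x = ∑ₙ aₙ/xⁿ` (with `a₀ = a₁ = 0`),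
absolutely convergent for `|x| > r`, and `p` is nonnegative on `|x| ≥ R`. -/
structure A2 (p : ℝ → ℝ) (a : ℕ → ℝ) (r R : ℝ) : Prop where
  hr : 0 < r
  hrR : r < R
  ha0 : a 0 = 0
  ha1 : a 1 = 0
  hsum : ∀ x : ℝ, r < |x| → HasSum (fun n => a n / x ^ n) (p x)
  habs : ∀ x : ℝ, r < |x| → Summable (fun n => |a n| / |x| ^ n)
  hpos : ∀ x : ℝ, R ≤ |x| → 0 ≤ p x

/-- The measure `λ(dx) = p(x) 1_{|x| ≥ R} dx`. -/
noncomputable def tailMeasure (p : ℝ → ℝ) (R : ℝ) : Measure ℝ :=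
  volume.withDensity (fun x => ENNReal.ofReal (if R ≤ |x| then p x else 0))

/-- The complex extension `p(z) = ∑ₙ aₙ/zⁿ` of the density. -/
noncomputable def pC (a : ℕ → ℝ) (z : ℂ) : ℂ := ∑' n : ℕ, (a n : ℂ) / z ^ n

/-- The complex extension of `u ↦ p(1/u)`, i.e. `∑ₙ aₙ uⁿ`. -/
noncomputable def pCInv (a : ℕ → ℝ) (u : ℂ) : ℂ := ∑' n : ℕ, (a n : ℂ) * u ^ n

/-- Contour integral over the circular arc of radius `c` centred at `0`,
with angle running from `θ₁` to `θ₂`. -/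
noncomputable def arcInt (θ₁ θ₂ c : ℝ) (f : ℂ → ℂ) : ℂ :=
  ∫ θ in θ₁..θ₂, (Complex.I * c * Complex.exp (θ * Complex.I)) *
    f (c * Complex.exp (θ * Complex.I))

/-- The Stieltjes transform of a measure on `ℝ`. -/
noncomputable def stieltjes (μ : Measure ℝ) (z : ℂ) : ℂ :=
  ∫ x, (z - x)⁻¹ ∂μ

/-- The Fourier transform of a measure on `ℝ`. -/
noncomputable def fourierTr (μ : Measure ℝ) (z : ℝ) : ℂ :=
  ∫ x, Complex.exp (Complex.I * x * z) ∂μ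

open Filter Topology Set in
/-- Cauchy's theorem on the exterior of a half disc: if `G` is holomorphic for `‖x‖ ≥ R` and
decays like `‖x‖⁻²` in the closed upper half plane, the integral of `G` over the two real
half-lines `|x| ≥ R` is minus its integral over the upper half circle from `-R` to `R`. -/
theorem integral_Iic_add_Ioi_eq_halfCircle {G : ℂ → ℂ} {R M : ℝ} (hR : 0 < R)
    (hG : DifferentiableOn ℂ G {x | R ≤ ‖x‖})
    (hM : ∀ x, R ≤ ‖x‖ → 0 ≤ x.im → ‖G x‖ ≤ M / ‖x‖ ^ 2) :
    IntegrableOn (fun x : ℝ => G x) (Iic (-R)) ∧ IntegrableOn (fun x : ℝ => G x) (Ioi R) ∧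
    (∫ x in Iic (-R), G (x : ℝ)) + ∫ x in Ioi R, G (x : ℝ) =
      I * ∫ θ in (0 : ℝ)..Real.pi, R * exp (θ * I) * G (R * exp (θ * I)) := by
  have hcont : ContinuousOn (fun x : ℝ => G x) (Ici R) := by
    refine hG.continuousOn.comp continuous_ofReal.continuousOn fun x (hx : R ≤ x) => ?_
    simpa using hx.trans (le_abs_self x)
  have hcont' : ContinuousOn (fun x : ℝ => G (-x : ℝ)) (Ici R) := by
    refine hG.continuousOn.comp (by fun_prop) fun x (hx : R ≤ x) => ?_
    simpa using hx.trans (le_abs_self x)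
  have hdom : IntegrableOn (fun x : ℝ => M * x ^ (-2 : ℝ)) (Ioi R) :=
    (integrableOn_Ioi_rpow_of_lt (by norm_num) hR).const_mul M
  have hint : IntegrableOn (fun x : ℝ => G x) (Ioi R) := by
    refine hdom.mono' ((hcont.mono Ioi_subset_Ici_self).aestronglyMeasurable measurableSet_Ioi) ?_
    refine ae_restrict_of_forall_mem measurableSet_Ioi fun x (hx : R < x) => ?_
    have hx0 : 0 < x := hR.trans hx
    have := hM x (by simpa using hx.le.trans (le_abs_self x)) (by simp)
    rw [Real.rpow_neg hx0.le, ← div_eq_mul_inv]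
    simpa using this
  have hint' : IntegrableOn (fun x : ℝ => G (-x : ℝ)) (Ioi R) := by
    refine hdom.mono' ((hcont'.mono Ioi_subset_Ici_self).aestronglyMeasurable measurableSet_Ioi) ?_
    refine ae_restrict_of_forall_mem measurableSet_Ioi fun x (hx : R < x) => ?_
    have hx0 : 0 < x := hR.trans hx
    have := hM (-x : ℝ) (by simpa using hx.le.trans (le_abs_self x)) (by simp)
    rw [Real.rpow_neg hx0.le, ← div_eq_mul_inv]
    simpa using this
  have hintIic : IntegrableOn (fun x : ℝ => G x) (Iic (-R)) := by
    have := ((integrableOn_Ici_iff_integrableOn_Ioi (by finiteness)).2 hint').comp_neg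
    simpa using this
  refine ⟨hintIic, hint, ?_⟩
  have hflip : ∫ x in Iic (-R), G (x : ℝ) = ∫ x in Ioi R, G (-x : ℝ) := by
    have := integral_comp_neg_Ioi R (fun x : ℝ => G x)
    rw [← this]
  rw [hflip, ← integral_add hint' hint]
  set h : ℝ → ℂ := fun x => G (-x : ℝ) + G x with hh
  set f : ℂ → ℂ := fun w => exp w * G (exp w) with hf
  set l := Real.log R with hl
  have hexpl : Real.exp l = R := Real.exp_log hR
  have hfd : DifferentiableOn ℂ f {w | l ≤ w.re} := by
    refine differentiable_exp.differentiableOn.mul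
      (hG.comp differentiable_exp.differentiableOn fun w (hw : l ≤ w.re) => ?_)
    rw [mem_ofPred_eq, norm_exp, ← hexpl]
    exact Real.exp_le_exp.2 hw
  have hrect : ∀ t, l ≤ t → (∫ x in R..Real.exp t, h x) =
      I * (∫ y in (0 : ℝ)..Real.pi, f (l + y * I)) - I * ∫ y in (0 : ℝ)..Real.pi, f (t + y * I) := by
    intro t ht
    have key := integral_boundary_rect_eq_zero_of_differentiableOn f l (t + Real.pi * I)
      (hfd.mono fun w hw => by
        have := hw.1
        simp [uIcc_of_le ht] at this
        exact this.1)
    simp only [ofReal_re, add_re, mul_re, I_re, mul_zero, ofReal_im, I_im, mul_one,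
      add_zero, add_im, mul_im, zero_add, ofReal_zero, zero_mul, smul_eq_mul, sub_self] at key
    have e1 : (∫ x in R..Real.exp t, h x) = ∫ s in l..t, (f s - f (s + Real.pi * I)) := by
      have := intervalIntegral.integral_deriv_smul_comp'' (a := l) (b := t) (f := Real.exp)
        (f' := Real.exp) (g := h) Real.continuous_exp.continuousOn
        (fun x _ => (Real.hasDerivAt_exp x).hasDerivWithinAt) Real.continuous_exp.continuousOn
        ((hcont'.add hcont).mono ?_)
      · rw [hexpl] at this
        rw [← this]
        refine intervalIntegral.integral_congr fun s _ => ?_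
        simp only [hf, hh, Function.comp, exp_add, exp_pi_mul_I, real_smul, ofReal_exp, ofReal_neg]
        ring_nf
      · rintro _ ⟨s, hs, rfl⟩
        rw [uIcc_of_le ht] at hs
        rw [mem_Ici, ← hexpl]
        exact Real.exp_le_exp.2 hs.1
    rw [e1, intervalIntegral.integral_sub]
    · linear_combination key
    · refine ContinuousOn.intervalIntegrable (hfd.continuousOn.comp (by fun_prop) fun s hs => ?_)
      rw [uIcc_of_le ht] at hs
      simpa using hs.1
    · refine ContinuousOn.intervalIntegrable (hfd.continuousOn.comp (by fun_prop) fun s hs => ?_)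
      rw [uIcc_of_le ht] at hs
      simpa using hs.1
  have hbig : Tendsto (fun t : ℝ => ∫ y in (0 : ℝ)..Real.pi, f (t + y * I)) atTop (𝓝 0) := by
    have hlim : Tendsto (fun t : ℝ => M * Real.exp (-t) * |Real.pi - 0|) atTop (𝓝 0) := by
      simpa using (Real.tendsto_exp_neg_atTop_nhds_zero.const_mul M).mul_const |Real.pi - 0|
    refine squeeze_zero_norm' ?_ hlim
    filter_upwards [eventually_ge_atTop l] with t ht
    refine intervalIntegral.norm_integral_le_of_norm_le_const fun y hy => ?_
    rw [uIoc_of_le Real.pi_pos.le] at hy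
    have hn : ‖exp (t + y * I)‖ = Real.exp t := by simp [norm_exp]
    have := hM (exp (t + y * I)) (by rw [hn, ← hexpl]; exact Real.exp_le_exp.2 ht) (by
      rw [exp_im]
      simpa using mul_nonneg (Real.exp_pos t).le (Real.sin_nonneg_of_nonneg_of_le_pi hy.1.le hy.2))
    rw [hn] at this
    rw [norm_mul, hn, Real.exp_neg]
    calc _ ≤ Real.exp t * (M / Real.exp t ^ 2) := by gcongr
      _ = _ := by field_simp
  have hL : Tendsto (fun t => ∫ x in R..Real.exp t, h x) atTop (𝓝 (∫ x in Ioi R, h x)) :=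
    intervalIntegral_tendsto_integral_Ioi R (hint'.add hint) Real.tendsto_exp_atTop
  have hL' : Tendsto (fun t => ∫ x in R..Real.exp t, h x) atTop
      (𝓝 (I * (∫ y in (0 : ℝ)..Real.pi, f (l + y * I)))) := by
    have := (tendsto_const_nhds (x := I * ∫ y in (0 : ℝ)..Real.pi, f (l + y * I))).sub
      (hbig.const_mul I)
    rw [mul_zero, sub_zero] at this
    refine this.congr' ?_
    filter_upwards [eventually_ge_atTop l] with t ht using (hrect t ht).symm
  rw [tendsto_nhds_unique hL hL']
  simp only [hf, exp_add, ← ofReal_exp, hexpl]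

theorem pCInv_eq_pC_inv (a : ℕ → ℝ) (u : ℂ) : pCInv a u = pC a u⁻¹ := by
  simp [pCInv, pC, div_eq_mul_inv]

theorem norm_coeff_div_pow_le (c : ℝ) (n : ℕ) {ρ : ℝ} (hρ : 0 < ρ) {x : ℂ} (hx : ρ ≤ ‖x‖) :
    ‖(c : ℂ) / x ^ n‖ ≤ |c| / ρ ^ n := by
  rw [norm_div, norm_pow, norm_real, Real.norm_eq_abs]
  gcongr

namespace A2

variable {p : ℝ → ℝ} {a : ℕ → ℝ} {r R : ℝ}

theorem R_pos (h : A2 p a r R) : 0 < R := h.hr.trans h.hrR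

theorem summable_of_lt (h : A2 p a r R) {ρ : ℝ} (hρ : r < ρ) :
    Summable fun n => |a n| / ρ ^ n := by
  have hρ0 : 0 < ρ := h.hr.trans hρ
  simpa [abs_of_pos hρ0] using h.habs ρ (by rwa [abs_of_pos hρ0])

theorem differentiableOn_pC (h : A2 p a r R) : DifferentiableOn ℂ (pC a) {x | R ≤ ‖x‖} := by
  obtain ⟨ρ, hrρ, hρR⟩ := exists_between h.hrR
  have hρ0 : 0 < ρ := h.hr.trans hrρ
  have : DifferentiableOn ℂ (pC a) {x | ρ < ‖x‖} := by
    refine differentiableOn_tsum_of_summable_norm (h.summable_of_lt hrρ) (fun n => ?_)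
      (isOpen_lt continuous_const continuous_norm) fun n x hx =>
        norm_coeff_div_pow_le _ _ hρ0 (le_of_lt hx)
    refine (differentiableOn_const _).div (differentiableOn_id.pow n) fun x hx => ?_
    exact pow_ne_zero _ (norm_pos_iff.1 (hρ0.trans hx))
  exact this.mono fun x hx => lt_of_lt_of_le hρR hx

theorem norm_pC_le (h : A2 p a r R) {x : ℂ} (hx : R ≤ ‖x‖) :
    ‖pC a x‖ ≤ (∑' n, |a n| / R ^ n) * R ^ 2 / ‖x‖ ^ 2 := by
  have hR := h.R_pos
  have hx0 : 0 < ‖x‖ := hR.trans_le hx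
  rw [mul_div_assoc]
  refine tsum_of_norm_bounded ((h.summable_of_lt h.hrR).hasSum.mul_right _) fun n => ?_
  match n with
  | 0 => simp [h.ha0]
  | 1 => simp [h.ha1]
  | n + 2 =>
    rw [norm_div, norm_pow, norm_real, Real.norm_eq_abs]
    calc |a (n + 2)| / ‖x‖ ^ (n + 2) = |a (n + 2)| / (‖x‖ ^ n * ‖x‖ ^ 2) := by rw [pow_add]
      _ ≤ |a (n + 2)| / (R ^ n * ‖x‖ ^ 2) := by gcongr
      _ = _ := by field_simp; ring

theorem pC_ofReal (h : A2 p a r R) {x : ℝ} (hx : r < |x|) : pC a x = p x := by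
  have := (h.hsum x hx).mapL ofRealCLM
  simpa [pC] using this.tsum_eq

theorem continuousOn_density (h : A2 p a r R) : ContinuousOn p {x | R ≤ |x|} := by
  have : ContinuousOn (fun x : ℝ => (pC a x).re) {x | R ≤ |x|} :=
    continuous_re.comp_continuousOn (h.differentiableOn_pC.continuousOn.comp
      continuous_ofReal.continuousOn fun x hx => by simpa using hx)
  refine this.congr fun x hx => ?_
  simp only [h.pC_ofReal (h.hrR.trans_le hx), ofReal_re]

theorem fourierTr_tailMeasure (h : A2 p a r R) (z : ℝ) :
    fourierTr (tailMeasure p R) z = ∫ x in {x : ℝ | R ≤ |x|}, exp (I * z * x) * pC a x := by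
  have hS : MeasurableSet {x : ℝ | R ≤ |x|} := measurableSet_le measurable_const measurable_norm
  have hμ : tailMeasure p R =
      (volume.restrict {x : ℝ | R ≤ |x|}).withDensity fun x => ENNReal.ofReal (p x) := by
    rw [← withDensity_indicator hS, tailMeasure]
    congr 1
    ext x
    by_cases hx : R ≤ |x| <;> simp [hx]
  rw [fourierTr, hμ, integral_withDensity_eq_integral_toReal_smul₀
    (h.continuousOn_density.aemeasurable hS).ennreal_ofReal (by simp)]
  refine setIntegral_congr_fun hS fun x hx => ?_
  simp only [ENNReal.toReal_ofReal (h.hpos x hx), real_smul, h.pC_ofReal (h.hrR.trans_le hx)]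
  ring_nf

theorem fourierTr_eq_halfCircle (h : A2 p a r R) {z : ℝ} (hz : 0 < z) :
    fourierTr (tailMeasure p R) z = I * ∫ θ in (0 : ℝ)..Real.pi,
      R * exp (θ * I) * (exp (I * z * (R * exp (θ * I))) * pC a (R * exp (θ * I))) := by
  have hR := h.R_pos
  obtain ⟨h1, h2, h3⟩ := integral_Iic_add_Ioi_eq_halfCircle
    (G := fun x => exp (I * z * x) * pC a x) (M := (∑' n, |a n| / R ^ n) * R ^ 2) hR
    (DifferentiableOn.mul (by fun_prop) h.differentiableOn_pC) fun x hx hxi => by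
      rw [norm_mul, norm_exp]
      refine (mul_le_of_le_one_left (norm_nonneg _) (Real.exp_le_one_iff.2 ?_)).trans
        (h.norm_pC_le hx)
      simpa using mul_nonneg hz.le hxi
  have hset : {x : ℝ | R ≤ |x|} = Set.Iic (-R) ∪ Set.Ici R := by
    ext x
    simp only [Set.mem_ofPred_eq, le_abs', Set.mem_union, Set.mem_Iic, Set.mem_Ici]
  rw [h.fourierTr_tailMeasure, ← h3, hset, setIntegral_union _ measurableSet_Ici h1
    ((integrableOn_Ici_iff_integrableOn_Ioi (by finiteness)).2 h2), integral_Ici_eq_integral_Ioi]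
  exact Set.Iic_disjoint_Ici.2 (by linarith)

theorem continuous_pC_circle (h : A2 p a r R) :
    Continuous fun θ : ℝ => pC a (R * exp (θ * I)) := by
  refine h.differentiableOn_pC.continuousOn.comp_continuous (by fun_prop) fun θ => ?_
  simp [norm_exp_ofReal_mul_I, le_abs_self]

end A2

/-- The contour integral over the lower half circle of radius `R⁻¹`, inverted into the upper half
circle of radius `R`. -/
theorem arcInt_inv_eq {R : ℝ} (hR : 0 < R) (a : ℕ → ℝ) (w : ℂ) :
    arcInt (-Real.pi) 0 R⁻¹ (fun u => exp (I * w / u) * pCInv a u / u ^ 2) =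
      I * ∫ θ in (0 : ℝ)..Real.pi,
        R * exp (θ * I) * (exp (I * w * (R * exp (θ * I))) * pC a (R * exp (θ * I))) := by
  have := intervalIntegral.integral_comp_neg (a := -Real.pi) (b := 0) fun θ : ℝ =>
    R * exp (θ * I) * (exp (I * w * (R * exp (θ * I))) * pC a (R * exp (θ * I)))
  rw [neg_zero, neg_neg] at this
  rw [← this, arcInt, ← intervalIntegral.integral_const_mul]
  refine intervalIntegral.integral_congr fun θ _ => ?_
  have hR' : (R : ℂ) ≠ 0 := ofReal_ne_zero.2 hR.ne'
  have hE : exp (θ * I) ≠ 0 := exp_ne_zero _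
  have hinv : ((R⁻¹ : ℝ) * exp (θ * I))⁻¹ = R * exp ((-θ : ℝ) * I) := by
    rw [ofReal_neg, neg_mul, exp_neg, mul_inv, ofReal_inv, inv_inv]
  simp only [pCInv_eq_pC_inv, div_eq_mul_inv (I * w), hinv]
  generalize exp (I * w * (R * exp ((-θ : ℝ) * I))) * pC a (R * exp ((-θ : ℝ) * I)) = q
  rw [ofReal_neg, neg_mul, exp_neg, ofReal_inv]
  field_simp

/-- Fourier–Laplace integrals of continuous functions over a compact interval are entire. -/
theorem differentiable_integral_mul_exp {c d : ℝ → ℂ} (hc : Continuous c) (hd : Continuous d)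
    (α β : ℝ) : Differentiable ℂ fun w : ℂ => ∫ θ in α..β, c θ * exp (w * d θ) := by
  intro w₀
  refine (intervalIntegral.hasDerivAt_integral_of_dominated_loc_of_deriv_le
    (F' := fun w θ => c θ * (exp (w * d θ) * d θ))
    (bound := fun θ => ‖c θ‖ * (Real.exp ((‖w₀‖ + 1) * ‖d θ‖) * ‖d θ‖))
    (Metric.ball_mem_nhds w₀ one_pos)
    (Filter.Eventually.of_forall fun w => (by fun_prop : Continuous _).aestronglyMeasurable)
    ((by fun_prop : Continuous _).intervalIntegrable _ _)
    (by fun_prop : Continuous _).aestronglyMeasurable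
    (ae_of_all _ fun θ _ w hw => ?_)
    ((by fun_prop : Continuous _).intervalIntegrable _ _)
    (ae_of_all _ fun θ _ w _ => ?_)).2.differentiableAt
  · rw [norm_mul, norm_mul]
    have hw' : ‖w‖ ≤ ‖w₀‖ + 1 := by
      have := norm_sub_norm_le w w₀
      rw [Metric.mem_ball, dist_eq_norm] at hw
      linarith
    gcongr
    refine (norm_exp_le_exp_norm _).trans (Real.exp_le_exp.2 ?_)
    rw [norm_mul]
    gcongr
  · simpa using ((hasDerivAt_id w).mul_const (d θ)).cexp.const_mul (c θ)

/-- Proposition 2.3: for a measure satisfying (A2), the Fourier transform on `z > 0` is the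
restriction of the entire function `w ↦ ∫_{C_R} e^{iw/u} p(1/u) u⁻² du`. -/
theorem fourier_entire_extension_A2
    (p : ℝ → ℝ) (a : ℕ → ℝ) (r R : ℝ) (hA2 : A2 p a r R) :
    Differentiable ℂ
      (fun w : ℂ =>
        arcInt (-Real.pi) 0 R⁻¹
          (fun u => Complex.exp (Complex.I * w / u) * pCInv a u / u ^ 2)) ∧
    (∀ z : ℝ, 0 < z →
      fourierTr (tailMeasure p R) z =
        arcInt (-Real.pi) 0 R⁻¹
          (fun u => Complex.exp (Complex.I * z / u) * pCInv a u / u ^ 2)) := by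
  refine ⟨?_, fun z hz => ?_⟩
  · simp only [arcInt_inv_eq hA2.R_pos]
    refine Differentiable.const_mul ?_ _
    have := differentiable_integral_mul_exp
      (c := fun θ : ℝ => R * exp (θ * I) * pC a (R * exp (θ * I)))
      (d := fun θ : ℝ => I * (R * exp (θ * I)))
      (Continuous.mul (by fun_prop) hA2.continuous_pC_circle) (by fun_prop) 0 Real.pi
    convert! this using 1
    refine funext fun w => intervalIntegral.integral_congr fun θ _ => ?_
    simp only [mul_comm I w, mul_assoc w]
    ring
  · rw [arcInt_inv_eq hA2.R_pos, hA2.fourierTr_eq_halfCircle hz]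
end

section
/- If a sequence of probability measures μ_N satisfies F_{μ_N}(z) → z - m for every z in the lower half-plane, where m = a + bi with b ≥ 0, then μ_N converges weakly to the Cauchy distribution μ_{a,b} (interpreted as δ_a when b = 0). -/
open MeasureTheory Complex

/-- The Cauchy distribution with location `a` and scale `b`. -/
noncomputable def cauchyMeasure (a b : ℝ) : Measure ℝ :=
  volume.withDensity (fun x => ENNReal.ofReal ((1 / Real.pi) * b / ((x - a) ^ 2 + b ^ 2)))

open scoped Classical in
/-- The Cauchy distribution `μ_{a,b}`, interpreted as `δ_a` when `b = 0`. -/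
noncomputable def cauchyOrDirac (a b : ℝ) : Measure ℝ :=
  if b = 0 then Measure.dirac a else cauchyMeasure a b

open Filter Topology NNReal

open ProbabilityTheory (cauchyPDFReal cauchyPDFReal_def cauchyPDF)

/-- **Scheffé's lemma**: pointwise convergence of nonnegative integrable functions together with
convergence of their integrals implies convergence in `L¹`. -/
theorem tendsto_integral_abs_sub_of_tendsto_integral {α : Type*} {mα : MeasurableSpace α}
    {μ : Measure α} {g : ℕ → α → ℝ} {h : α → ℝ} (hg_nonneg : ∀ n x, 0 ≤ g n x)
    (hg : ∀ n, Integrable (g n) μ) (hh : Integrable h μ)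
    (hlim : ∀ x, Tendsto (fun n => g n x) atTop (𝓝 (h x)))
    (hI : Tendsto (fun n => ∫ x, g n x ∂μ) atTop (𝓝 (∫ x, h x ∂μ))) :
    Tendsto (fun n => ∫ x, |g n x - h x| ∂μ) atTop (𝓝 0) := by
  have hpos : Tendsto (fun n => ∫ x, max (h x - g n x) 0 ∂μ) atTop (𝓝 0) := by
    have key : Tendsto (fun n => ∫ x, max (h x - g n x) 0 ∂μ) atTop (𝓝 (∫ _, (0 : ℝ) ∂μ)) := by
      refine tendsto_integral_of_dominated_convergence (fun x => |h x|)
        (fun n => (hh.sub (hg n)).pos_part.aestronglyMeasurable) hh.abs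
        (fun n => ae_of_all _ fun x => ?_) (ae_of_all _ fun x => ?_)
      · rw [Real.norm_of_nonneg (le_max_right _ _)]
        exact max_le (by linarith [le_abs_self (h x), hg_nonneg n x]) (abs_nonneg _)
      · simpa using ((hlim x).const_sub (h x)).max (tendsto_const_nhds (x := (0 : ℝ)))
    simpa using key
  have heq : ∀ n, ∫ x, |g n x - h x| ∂μ
      = (∫ x, g n x ∂μ - ∫ x, h x ∂μ) + 2 * ∫ x, max (h x - g n x) 0 ∂μ := by
    intro n
    have hadd := integral_add ((hg n).sub hh) ((hh.sub (hg n)).pos_part.const_mul 2)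
    simp only [Pi.sub_apply] at hadd
    rw [← integral_sub (hg n) hh, ← integral_const_mul, ← hadd]
    refine integral_congr_ae (ae_of_all _ fun x => ?_)
    change |g n x - h x| = (g n x - h x) + 2 * max (h x - g n x) 0
    rcases le_total (h x) (g n x) with hx | hx
    · rw [abs_of_nonneg (by linarith), max_eq_right (by linarith)]; ring
    · rw [abs_of_nonpos (by linarith), max_eq_left (by linarith)]; ring
  simp_rw [heq]
  simpa using (hI.sub_const (∫ x, h x ∂μ)).add (hpos.const_mul 2)

theorem tendsto_integral_mul_of_tendsto_integral {α : Type*} {mα : MeasurableSpace α}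
    {μ : Measure α} {g : ℕ → α → ℝ} {h : α → ℝ} (hg_nonneg : ∀ n x, 0 ≤ g n x)
    (hg : ∀ n, Integrable (g n) μ) (hh : Integrable h μ)
    (hlim : ∀ x, Tendsto (fun n => g n x) atTop (𝓝 (h x)))
    (hI : Tendsto (fun n => ∫ x, g n x ∂μ) atTop (𝓝 (∫ x, h x ∂μ)))
    {f : α → ℝ} (hf : AEStronglyMeasurable f μ) {C : ℝ} (hC : ∀ x, ‖f x‖ ≤ C) :
    Tendsto (fun n => ∫ x, g n x * f x ∂μ) atTop (𝓝 (∫ x, h x * f x ∂μ)) := by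
  rw [tendsto_iff_norm_sub_tendsto_zero]
  refine squeeze_zero (fun _ => norm_nonneg _) (fun n => ?_)
    (by simpa using (tendsto_integral_abs_sub_of_tendsto_integral hg_nonneg hg hh hlim
      hI).const_mul C)
  have hCae := ae_of_all μ hC
  rw [← integral_sub ((hg n).mul_bdd hf hCae) (hh.mul_bdd hf hCae), ← integral_const_mul]
  refine norm_integral_le_of_norm_le (((hg n).sub hh).abs.const_mul C) (ae_of_all _ fun x => ?_)
  rw [← sub_mul, norm_mul, mul_comm, Real.norm_eq_abs (g n x - h x)]
  exact mul_le_mul_of_nonneg_right (hC x) (abs_nonneg _)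

theorem cauchyOrDirac_eq (a : ℝ) (γ : ℝ≥0) :
    cauchyOrDirac a γ = ProbabilityTheory.cauchyMeasure a γ := by
  by_cases h : γ = 0
  · simp [cauchyOrDirac, h]
  · have : (γ : ℝ) ≠ 0 := by exact_mod_cast h
    rw [cauchyOrDirac, if_neg this, ProbabilityTheory.cauchyMeasure_of_scale_ne_zero _ h,
      cauchyMeasure]
    congr 1
    ext x
    rw [ProbabilityTheory.cauchyPDF_def, cauchyPDFReal_def, one_div, div_eq_mul_inv]

theorem integral_cauchyMeasure (a : ℝ) {γ : ℝ≥0} (hγ : γ ≠ 0) (f : ℝ → ℝ) :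
    ∫ x, f x ∂(ProbabilityTheory.cauchyMeasure a γ) = ∫ x, cauchyPDFReal a γ x * f x := by
  rw [ProbabilityTheory.cauchyMeasure_of_scale_ne_zero _ hγ,
    integral_withDensity_eq_integral_toReal_smul (by fun_prop)
      (ae_of_all _ fun x => by simp [cauchyPDF])]
  refine integral_congr_ae (ae_of_all _ fun x => ?_)
  simp [cauchyPDF, ENNReal.toReal_ofReal (ProbabilityTheory.cauchyPDF_pos a hγ x).le]

/-- The Cauchy distribution is the image of the standard one under `s ↦ a + γ * s`. -/
theorem integral_cauchyMeasure_eq_integral_standard (a : ℝ) (γ : ℝ≥0) (f : ℝ → ℝ) :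
    ∫ x, f x ∂(ProbabilityTheory.cauchyMeasure a γ)
      = ∫ s, f (a + γ * s) ∂(ProbabilityTheory.cauchyMeasure 0 1) := by
  by_cases hγ : γ = 0
  · simp [hγ]
  have hγ' : (0 : ℝ) < γ := by exact_mod_cast pos_iff_ne_zero.2 hγ
  rw [integral_cauchyMeasure a hγ, integral_cauchyMeasure 0 one_ne_zero]
  have key := Measure.integral_comp_mul_left
    (fun x => (γ : ℝ) * (cauchyPDFReal a γ (a + x) * f (a + x))) γ
  rw [integral_const_mul, integral_const_mul,
    integral_add_left_eq_self (μ := volume) (fun x => cauchyPDFReal a γ x * f x) a,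
    smul_eq_mul, abs_of_pos (inv_pos.2 hγ'), inv_mul_cancel_left₀ hγ'.ne'] at key
  rw [← key, ← integral_const_mul]
  refine integral_congr_ae (ae_of_all _ fun s => ?_)
  simp only [cauchyPDFReal_def]
  have : s ^ 2 + 1 ≠ 0 := by positivity
  simp
  field_simp

theorem norm_inv_sub_ofReal_le {y : ℝ} (hy : 0 < y) (x t : ℝ) :
    ‖((x : ℂ) - y * I - t)⁻¹‖ ≤ y⁻¹ := by
  rw [norm_inv]
  gcongr
  simpa [abs_of_pos hy] using abs_im_le_norm ((x : ℂ) - y * I - t)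

/-- The imaginary part of the Stieltjes transform is a multiple of the Cauchy smoothing. -/
theorem im_stieltjes (μ : Measure ℝ) [IsFiniteMeasure μ] {γ : ℝ≥0} (hγ : γ ≠ 0) (x : ℝ) :
    (stieltjes μ (x - (γ : ℝ) * I)).im = Real.pi * ∫ t, cauchyPDFReal t γ x ∂μ := by
  have hγ' : (0 : ℝ) < γ := by exact_mod_cast pos_iff_ne_zero.2 hγ
  have hI : Integrable (fun t : ℝ => ((x : ℂ) - (γ : ℝ) * I - t)⁻¹) μ :=
    Integrable.of_bound (by fun_prop) _ (ae_of_all _ fun t => norm_inv_sub_ofReal_le hγ' x t)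
  rw [stieltjes, ← integral_const_mul]
  refine (integral_im hI).symm.trans (integral_congr_ae (ae_of_all _ fun t => ?_))
  have hp := Real.pi_pos.ne'
  simp only [RCLike.im_to_complex, inv_im, normSq_apply, cauchyPDFReal_def]
  simp
  field_simp

theorem measurable_uncurry_cauchyPDFReal (γ : ℝ≥0) :
    Measurable fun p : ℝ × ℝ => cauchyPDFReal p.2 γ p.1 := by
  simp only [cauchyPDFReal_def]
  fun_prop

theorem integrable_uncurry_cauchyPDFReal (μ : Measure ℝ) [IsFiniteMeasure μ] {γ : ℝ≥0}
    (hγ : γ ≠ 0) :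
    Integrable (fun p : ℝ × ℝ => cauchyPDFReal p.2 γ p.1) (volume.prod μ) := by
  rw [integrable_prod_iff' (measurable_uncurry_cauchyPDFReal γ).aestronglyMeasurable]
  refine ⟨ae_of_all _ fun t => ProbabilityTheory.integrable_cauchyPDFReal t, ?_⟩
  simp_rw [Real.norm_of_nonneg (ProbabilityTheory.cauchyPDF_pos _ hγ _).le,
    ProbabilityTheory.integral_cauchyPDFReal_eq_one _ hγ]
  exact integrable_const _

theorem integral_integral_cauchyPDFReal_mul (μ : Measure ℝ) [IsFiniteMeasure μ] {γ : ℝ≥0}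
    (hγ : γ ≠ 0) {f : ℝ → ℝ} (hf : Measurable f) {C : ℝ} (hC : ∀ x, ‖f x‖ ≤ C) :
    ∫ x, (∫ t, cauchyPDFReal t γ x ∂μ) * f x
      = ∫ t, ∫ s, f (t + γ * s) ∂(ProbabilityTheory.cauchyMeasure 0 1) ∂μ := by
  simp_rw [← integral_cauchyMeasure_eq_integral_standard, integral_cauchyMeasure _ hγ,
    ← integral_mul_const]
  exact integral_integral_swap ((integrable_uncurry_cauchyPDFReal μ hγ).mul_bdd
    (hf.comp measurable_fst).aestronglyMeasurable (ae_of_all _ fun p => hC p.1))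

theorem tendsto_integral_cauchyPDFReal {μs : ℕ → Measure ℝ}
    (hprob : ∀ N, IsProbabilityMeasure (μs N)) {a : ℝ} {β : ℝ≥0}
    (hF : ∀ z : ℂ, z.im < 0 → Tendsto (fun N => (stieltjes (μs N) z)⁻¹) atTop
      (𝓝 (z - (a + I * (β : ℝ))))) {γ : ℝ≥0} (hγ : γ ≠ 0) (x : ℝ) :
    Tendsto (fun N => ∫ t, cauchyPDFReal t γ x ∂(μs N)) atTop
      (𝓝 (cauchyPDFReal a (β + γ) x)) := by
  have hγ' : (0 : ℝ) < γ := by exact_mod_cast pos_iff_ne_zero.2 hγ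
  have hz : ((x : ℂ) - (γ : ℝ) * I).im < 0 := by simpa using hγ'
  have hne : (x : ℂ) - (γ : ℝ) * I - (a + I * (β : ℝ)) ≠ 0 := by
    intro h
    have := congrArg im h
    simp at this
    linarith [β.coe_nonneg]
  have h := (continuous_im.tendsto _).comp ((hF _ hz).inv₀ hne)
  simp only [Function.comp_def, inv_inv, im_stieltjes _ hγ] at h
  have hp := Real.pi_pos.ne'
  convert h.const_mul Real.pi⁻¹ using 2
  · rw [inv_mul_cancel_left₀ hp]
  · simp only [inv_im, normSq_apply, cauchyPDFReal_def]
    have hden : (x - a) ^ 2 + ((β : ℝ) + γ) ^ 2 ≠ 0 := by positivity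
    have heq : (x - a) * (x - a) + (-(γ : ℝ) - β) * (-(γ : ℝ) - β)
        = (x - a) ^ 2 + ((β : ℝ) + γ) ^ 2 := by ring
    simp
    rw [heq]
    field_simp

theorem tendsto_integral_cauchy_smoothing {μs : ℕ → Measure ℝ}
    (hprob : ∀ N, IsProbabilityMeasure (μs N)) {a : ℝ} {β : ℝ≥0}
    (hF : ∀ z : ℂ, z.im < 0 → Tendsto (fun N => (stieltjes (μs N) z)⁻¹) atTop
      (𝓝 (z - (a + I * (β : ℝ))))) {γ : ℝ≥0} (hγ : γ ≠ 0)
    {f : ℝ → ℝ} (hf : Measurable f) {C : ℝ} (hC : ∀ x, ‖f x‖ ≤ C) :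
    Tendsto (fun N => ∫ t, ∫ s, f (t + γ * s) ∂(ProbabilityTheory.cauchyMeasure 0 1) ∂(μs N)) atTop
      (𝓝 (∫ s, f (a + ((β + γ : ℝ≥0) : ℝ) * s) ∂(ProbabilityTheory.cauchyMeasure 0 1))) := by
  have hβγ : β + γ ≠ 0 := by simp [hγ]
  simp_rw [← integral_integral_cauchyPDFReal_mul _ hγ hf hC,
    ← integral_cauchyMeasure_eq_integral_standard, integral_cauchyMeasure _ hβγ]
  refine tendsto_integral_mul_of_tendsto_integral
    (fun N x => integral_nonneg fun t => (ProbabilityTheory.cauchyPDF_pos t hγ x).le)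
    (fun N => (integrable_uncurry_cauchyPDFReal (μs N) hγ).integral_prod_left)
    (ProbabilityTheory.integrable_cauchyPDFReal a)
    (tendsto_integral_cauchyPDFReal hprob hF hγ) ?_ hf.aestronglyMeasurable hC
  rw [ProbabilityTheory.integral_cauchyPDFReal_eq_one a hβγ]
  refine tendsto_const_nhds.congr fun N => ?_
  have h := integral_integral_cauchyPDFReal_mul (μs N) hγ (f := fun _ => 1) (C := 1)
    measurable_const (by simp)
  simpa using h.symm

/-- Smoothing a bounded Lipschitz function by a Cauchy kernel of small scale changes it little,
uniformly over all probability measures. -/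
theorem tendstoUniformly_integral_cauchy_smoothing {μs : ℕ → Measure ℝ}
    (hprob : ∀ N, IsProbabilityMeasure (μs N)) {f : ℝ → ℝ} {L : ℝ≥0} (hL : LipschitzWith L f)
    {C : ℝ} (hC : ∀ x, ‖f x‖ ≤ C) :
    TendstoUniformly
      (fun (γ : ℝ≥0) N => ∫ t, ∫ s, f (t + γ * s) ∂(ProbabilityTheory.cauchyMeasure 0 1) ∂(μs N))
      (fun N => ∫ t, f t ∂(μs N)) (𝓝[≠] 0) := by
  set κ := ProbabilityTheory.cauchyMeasure 0 1 with hκ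
  have hC0 : 0 ≤ C := (norm_nonneg _).trans (hC 0)
  have hf : Continuous f := hL.continuous
  have hmod : Tendsto (fun γ : ℝ≥0 => ∫ s, min (L * ‖(γ : ℝ) * s‖) (C + C) ∂κ) (𝓝[≠] 0)
      (𝓝 0) := by
    have hcont : Continuous fun γ : ℝ≥0 => ∫ s, min (L * ‖(γ : ℝ) * s‖) (C + C) ∂κ := by
      refine continuous_of_dominated (bound := fun _ => C + C) (fun γ => by fun_prop)
        (fun γ => ae_of_all _ fun s => ?_) (integrable_const _)
        (ae_of_all _ fun s => by fun_prop)
      rw [Real.norm_of_nonneg (by positivity)]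
      exact min_le_right _ _
    have h0 := hcont.tendsto 0
    have hz : ∫ s, min (L * ‖((0 : ℝ≥0) : ℝ) * s‖) (C + C) ∂κ = 0 := by
      simp [hC0]
    rw [hz] at h0
    exact h0.mono_left nhdsWithin_le_nhds
  rw [Metric.tendstoUniformly_iff]
  intro ε hε
  filter_upwards [hmod.eventually_lt_const hε] with γ hγ N
  refine lt_of_le_of_lt ?_ hγ
  have hfs : ∀ t, Integrable (fun s => f (t + γ * s)) κ := fun t =>
    Integrable.of_bound (by fun_prop) C (ae_of_all _ fun s => hC _)
  have hfi : Integrable f (μs N) :=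
    Integrable.of_bound hf.aestronglyMeasurable C (ae_of_all _ hC)
  have hsm : Integrable (fun t => ∫ s, f (t + γ * s) ∂κ) (μs N) := by
    refine Integrable.of_bound
      (Continuous.aestronglyMeasurable ?_) C (ae_of_all _ fun t => ?_)
    · exact continuous_of_dominated (bound := fun _ => C) (fun t => by fun_prop)
        (fun t => ae_of_all _ fun s => hC _) (integrable_const _)
        (ae_of_all _ fun s => by fun_prop)
    · simpa using norm_integral_le_of_norm_le_const (μ := κ) (ae_of_all _ fun s => hC (t + γ * s))
  rw [dist_comm, dist_eq_norm, ← integral_sub hsm hfi]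
  have hbound : ∀ t, ‖∫ s, f (t + γ * s) ∂κ - f t‖
      ≤ ∫ s, min (L * ‖(γ : ℝ) * s‖) (C + C) ∂κ := by
    intro t
    have hconst : f t = ∫ _, f t ∂κ := by simp
    rw [hconst, ← integral_sub (hfs t) (integrable_const _)]
    refine norm_integral_le_of_norm_le ?_ (ae_of_all _ fun s => le_min ?_ ?_)
    · refine Integrable.of_bound (by fun_prop) (C + C) (ae_of_all _ fun s => ?_)
      rw [Real.norm_of_nonneg (by positivity)]
      exact min_le_right _ _
    · simpa using hL.norm_sub_le (t + γ * s) t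
    · exact (norm_sub_le _ _).trans (add_le_add (hC _) (hC _))
  simpa using norm_integral_le_of_norm_le_const (μ := μs N) (ae_of_all _ hbound)

theorem tendsto_integral_of_lipschitz {μs : ℕ → Measure ℝ}
    (hprob : ∀ N, IsProbabilityMeasure (μs N)) {a : ℝ} {β : ℝ≥0}
    (hF : ∀ z : ℂ, z.im < 0 → Tendsto (fun N => (stieltjes (μs N) z)⁻¹) atTop
      (𝓝 (z - (a + I * (β : ℝ)))))
    {f : ℝ → ℝ} {L : ℝ≥0} (hL : LipschitzWith L f) {C : ℝ} (hC : ∀ x, ‖f x‖ ≤ C) :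
    Tendsto (fun N => ∫ x, f x ∂(μs N)) atTop
      (𝓝 (∫ x, f x ∂(ProbabilityTheory.cauchyMeasure a β))) := by
  have hf : Continuous f := hL.continuous
  refine (tendstoUniformly_integral_cauchy_smoothing hprob hL hC).tendsto_of_eventually_tendsto
    (eventually_mem_nhdsWithin.mono fun γ hγ =>
      tendsto_integral_cauchy_smoothing hprob hF hγ hf.measurable hC) ?_
  have hcont : Continuous fun γ : ℝ≥0 =>
      ∫ s, f (a + ((β + γ : ℝ≥0) : ℝ) * s) ∂(ProbabilityTheory.cauchyMeasure 0 1) :=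
    continuous_of_dominated (bound := fun _ => C) (fun γ => by fun_prop)
      (fun γ => ae_of_all _ fun s => hC _) (integrable_const _) (ae_of_all _ fun s => by fun_prop)
  have h0 := hcont.tendsto 0
  rw [add_zero, ← integral_cauchyMeasure_eq_integral_standard] at h0
  exact h0.mono_left nhdsWithin_le_nhds

/-- If the reciprocal Stieltjes transforms `F_{μ_N}` converge pointwise on the lower
half-plane to `z - (a + bi)` with `b ≥ 0`, then `μ_N → μ_{a,b}` weakly
(`δ_a` when `b = 0`). -/
theorem weak_convergence_of_F_tendsto
    (μs : ℕ → Measure ℝ) (hprob : ∀ N, IsProbabilityMeasure (μs N))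
    (a b : ℝ) (hb : 0 ≤ b)
    (hF : ∀ z : ℂ, z.im < 0 →
      Filter.Tendsto (fun N => (stieltjes (μs N) z)⁻¹) Filter.atTop
        (nhds (z - (a + Complex.I * b)))) :
    ∀ f : BoundedContinuousFunction ℝ ℝ,
      Filter.Tendsto (fun N => ∫ x, f x ∂(μs N)) Filter.atTop
        (nhds (∫ x, f x ∂(cauchyOrDirac a b))) := by
  lift b to ℝ≥0 using hb with β
  intro f
  rw [cauchyOrDirac_eq]
  let ν : ℕ → ProbabilityMeasure ℝ := fun N => ⟨μs N, hprob N⟩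
  let ν' : ProbabilityMeasure ℝ := ⟨ProbabilityTheory.cauchyMeasure a β, inferInstance⟩
  have hν : Tendsto ν atTop (𝓝 ν') := by
    rw [tendsto_iff_forall_lipschitz_integral_tendsto]
    rintro g ⟨C, hC⟩ ⟨L, hL⟩
    refine tendsto_integral_of_lipschitz hprob hF hL (C := ‖g 0‖ + C) fun x => ?_
    calc ‖g x‖ ≤ ‖g 0‖ + ‖g x - g 0‖ := norm_le_insert' _ _
      _ ≤ ‖g 0‖ + C := by gcongr; simpa [dist_eq_norm] using hC x 0
  exact ProbabilityMeasure.tendsto_iff_forall_integral_tendsto.1 hν f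
end

section
/- Let μ ∈ P₂ with complex first moment m₁(μ) = a + bi (b ≥ 0). Then the N-fold classical convolution power of the dilation D_{1/N}μ converges weakly to the Cauchy distribution μ_{a,b} as N → ∞ (δ_a if b = 0). -/
open MeasureTheory Complex

/-- Classical (tensor) convolution of two measures on `ℝ`. -/
noncomputable def mconv (μ ν : Measure ℝ) : Measure ℝ :=
  (μ.prod ν).map (fun q => q.1 + q.2)

/-- `N`-fold classical convolution power of a measure. -/
noncomputable def mconvPow (μ : Measure ℝ) : ℕ → Measure ℝ
  | 0 => Measure.dirac 0
  | (N + 1) => mconv μ (mconvPow μ N)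

/-- Dilation: `D_c μ` is the pushforward of `μ` under `x ↦ c x`. -/
noncomputable def dilate (c : ℝ) (μ : Measure ℝ) : Measure ℝ :=
  μ.map (fun x => c * x)

open scoped FourierTransform in
/-- The Fourier transform of the Laplace density `exp (-|x|)`. -/
lemma fourier_exp_neg_abs (w : ℝ) :
    𝓕 (fun x : ℝ => (Real.exp (-|x|) : ℂ)) w =
      ((2 * (1 + (2 * Real.pi * w) ^ 2)⁻¹ : ℝ) : ℂ) := by
  rw [Real.fourier_real_eq_integral_exp_smul]
  obtain ⟨s, hs⟩ : ∃ s : ℂ, s = 2 * Real.pi * w * I := ⟨_, rfl⟩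
  have hs_re : s.re = 0 := by simp [hs]
  have h1 : (-1 - s).re < 0 := by simp [hs_re]
  have h2 : 0 < (1 - s).re := by simp [hs_re]
  have e1 : Set.EqOn (fun v : ℝ => Complex.exp (((-2 * Real.pi * v * w : ℝ) : ℂ) * I) •
      (Real.exp (-|v|) : ℂ)) (fun v : ℝ => Complex.exp ((-1 - s) * v)) (Set.Ioi 0) := by
    intro v hv
    simp only [abs_of_pos (Set.mem_Ioi.mp hv), smul_eq_mul, ofReal_exp, ← Complex.exp_add, hs]
    congr 1; push_cast; ring
  have e2 : Set.EqOn (fun v : ℝ => Complex.exp (((-2 * Real.pi * v * w : ℝ) : ℂ) * I) •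
      (Real.exp (-|v|) : ℂ)) (fun v : ℝ => Complex.exp ((1 - s) * v)) (Set.Iic 0) := by
    intro v hv
    simp only [abs_of_nonpos (Set.mem_Iic.mp hv), smul_eq_mul, ofReal_exp, ← Complex.exp_add, hs]
    congr 1; push_cast; ring
  rw [← intervalIntegral.integral_Iic_add_Ioi (b := 0)
    ((integrableOn_congr_fun e2 measurableSet_Iic).2 (integrableOn_exp_mul_complex_Iic h2 0))
    ((integrableOn_congr_fun e1 measurableSet_Ioi).2 (integrableOn_exp_mul_complex_Ioi h1 0)),
    setIntegral_congr_fun measurableSet_Iic e2, setIntegral_congr_fun measurableSet_Ioi e1,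
    integral_exp_mul_complex_Iic h2, integral_exp_mul_complex_Ioi h1]
  have n1 : (-1 - s) ≠ 0 := fun h => by simp [h] at h1
  have n2 : (1 - s) ≠ 0 := fun h => by simp [h] at h2
  have hs2 : (1 + (2 * Real.pi * w) ^ 2 : ℂ) = -((1 - s) * (-1 - s)) := by
    linear_combination (s + 2 * Real.pi * w * I) * hs + (2 * Real.pi * w) ^ 2 * I_sq
  push_cast
  rw [hs2]
  simp only [mul_zero, Complex.exp_zero]
  field_simp
  ring

lemma integrable_exp_neg_abs : Integrable fun x : ℝ => Real.exp (-|x|) := by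
  rw [← integrableOn_univ, ← Set.Iic_union_Ioi (a := (0 : ℝ))]
  refine IntegrableOn.union
    ((integrableOn_congr_fun (g := fun x : ℝ => Real.exp (1 * x)) ?_ measurableSet_Iic).2
      (integrableOn_exp_mul_Iic one_pos 0))
    ((integrableOn_congr_fun (g := fun x : ℝ => Real.exp (-1 * x)) ?_ measurableSet_Ioi).2
      (integrableOn_exp_mul_Ioi (by norm_num) 0))
  · intro x hx; simp [abs_of_nonpos (Set.mem_Iic.mp hx)]
  · intro x hx; simp [abs_of_pos (Set.mem_Ioi.mp hx)]

open scoped FourierTransform in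
/-- The Fourier transform of the standard Cauchy density, up to the factor `π⁻¹`. -/
lemma integral_exp_mul_inv_one_add_sq (t : ℝ) :
    ∫ x : ℝ, Complex.exp (t * x * I) * (((1 + x ^ 2)⁻¹ : ℝ) : ℂ) =
      Real.pi * Complex.exp ((-|t| : ℝ) : ℂ) := by
  have hF : 𝓕 (fun x : ℝ => (Real.exp (-|x|) : ℂ)) =
      fun w : ℝ => ((2 * (1 + (2 * Real.pi * w) ^ 2)⁻¹ : ℝ) : ℂ) :=
    funext fourier_exp_neg_abs
  have hint : Integrable fun w : ℝ => ((2 * (1 + (2 * Real.pi * w) ^ 2)⁻¹ : ℝ) : ℂ) :=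
    ((integrable_inv_one_add_sq.comp_mul_left' (by positivity)).const_mul 2).ofReal
  have hinv := Continuous.fourierInv_fourier_eq
    (f := fun x : ℝ => (Real.exp (-|x|) : ℂ)) (by fun_prop) integrable_exp_neg_abs.ofReal
    (by rw [hF]; exact hint)
  have ht := congrFun hinv t
  rw [hF, Real.fourierInv_eq'] at ht
  have hsub := Measure.integral_comp_mul_left
    (fun x : ℝ => Complex.exp (t * x * I) * (((1 + x ^ 2)⁻¹ : ℝ) : ℂ)) (2 * Real.pi)
  have habs : |(2 * Real.pi)⁻¹| = (2 * Real.pi)⁻¹ := abs_of_pos (by positivity)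
  rw [habs] at hsub
  have heq : (fun v : ℝ => Complex.exp (((2 * Real.pi * inner ℝ v t : ℝ) : ℂ) * I) •
      ((2 * (1 + (2 * Real.pi * v) ^ 2)⁻¹ : ℝ) : ℂ)) = fun v : ℝ =>
      2 * (Complex.exp (t * (2 * Real.pi * v : ℝ) * I) *
        (((1 + (2 * Real.pi * v) ^ 2)⁻¹ : ℝ) : ℂ)) := by
    ext v
    simp only [RCLike.inner_apply, conj_trivial, smul_eq_mul]
    push_cast
    rw [show (2 * Real.pi * (t * v) * I : ℂ) = t * (2 * Real.pi * v) * I by ring]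
    ring
  rw [heq, integral_const_mul, hsub, real_smul] at ht
  rw [ofReal_exp] at ht
  rw [← ht]
  generalize (∫ y : ℝ, Complex.exp (t * y * I) * (((1 + y ^ 2)⁻¹ : ℝ) : ℂ)) = J
  have : (Real.pi : ℂ) ≠ 0 := by exact_mod_cast Real.pi_ne_zero
  push_cast
  field_simp

lemma tendsto_nat_mul_exp_div_sub_one (z : ℂ) :
    Filter.Tendsto (fun N : ℕ => (N : ℂ) * (Complex.exp (z / N) - 1)) Filter.atTop (nhds z) := by
  have hd : HasDerivAt (fun s : ℝ => Complex.exp (s * z)) z 0 := by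
    have := ((hasDerivAt_id (0 : ℝ)).ofReal_comp.mul_const z).cexp
    simpa using this
  have := (hasDerivAt_iff_tendsto_slope_zero.1 hd).comp
    ((tendsto_inv_atTop_nhdsGT_zero.mono_right
      (nhdsWithin_mono _ (fun x hx => (Set.mem_Ioi.1 hx).ne'))).comp tendsto_natCast_atTop_atTop)
  refine this.congr fun N => ?_
  simp [div_eq_inv_mul]

/-- Linearisation of `x ↦ exp (i t x / N)` against a density with finite first moment. -/
lemma tendsto_integral_nat_mul_exp_div_sub_one {m : Measure ℝ} {h : ℝ → ℂ}
    (hm : AEStronglyMeasurable h m) (hx : Integrable (fun x : ℝ => (x : ℂ) * h x) m) (t : ℝ) :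
    Filter.Tendsto (fun N : ℕ => ∫ x : ℝ, (N : ℂ) * (Complex.exp (t * x * I / N) - 1) * h x ∂m)
      Filter.atTop (nhds (t * I * ∫ x : ℝ, (x : ℂ) * h x ∂m)) := by
  rw [← integral_const_mul]
  refine tendsto_integral_of_dominated_convergence (fun x => |t| * ‖(x : ℂ) * h x‖) ?_
    (hx.norm.const_mul _) ?_ ?_
  · intro N
    refine AEStronglyMeasurable.mul (Continuous.aestronglyMeasurable ?_) hm
    fun_prop
  · refine fun N => ae_of_all _ fun x => ?_
    rw [norm_mul, norm_mul, norm_mul, ← mul_assoc]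
    refine mul_le_mul_of_nonneg_right ?_ (norm_nonneg _)
    have := Real.norm_exp_I_mul_ofReal_sub_one_le (x := t * x / N)
    rw [show I * ((t * x / N : ℝ) : ℂ) = t * x * I / N by push_cast; ring] at this
    rcases Nat.eq_zero_or_pos N with rfl | hN
    · simp; positivity
    · have hN' : (0 : ℝ) < N := by exact_mod_cast hN
      calc ‖(N : ℂ)‖ * ‖Complex.exp (t * x * I / N) - 1‖ ≤ N * ‖t * x / N‖ := by
            rw [Complex.norm_natCast]; gcongr
        _ = |t| * ‖(x : ℂ)‖ := by
            simp only [Real.norm_eq_abs, Complex.norm_real, abs_div, abs_mul, Nat.abs_cast]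
            field_simp
  · refine ae_of_all _ fun x => ?_
    convert (tendsto_nat_mul_exp_div_sub_one (t * x * I)).mul_const (h x) using 2
    ring

lemma tendsto_integral_nat_mul_exp_div_sub_one_inv_one_add_sq (t : ℝ) :
    Filter.Tendsto (fun N : ℕ => ∫ x : ℝ, (N : ℂ) * (Complex.exp (t * x * I / N) - 1) *
      (((1 + x ^ 2)⁻¹ : ℝ) : ℂ)) Filter.atTop (nhds (-(Real.pi * |t| : ℝ))) := by
  have h := (tendsto_nat_mul_exp_div_sub_one ((-|t| : ℝ) : ℂ)).const_mul (Real.pi : ℂ)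
  rw [show ((-(Real.pi * |t| : ℝ)) : ℂ) = (Real.pi : ℂ) * ((-|t| : ℝ) : ℂ) by push_cast; ring]
  refine h.congr fun N => ?_
  have hi : Integrable fun x : ℝ => (((1 + x ^ 2)⁻¹ : ℝ) : ℂ) := integrable_inv_one_add_sq.ofReal
  have hi' : Integrable fun x : ℝ => Complex.exp ((t / N : ℝ) * x * I) *
      (((1 + x ^ 2)⁻¹ : ℝ) : ℂ) := by
    refine hi.bdd_mul (c := 1) (Continuous.aestronglyMeasurable (by fun_prop)) ?_
    refine ae_of_all _ fun x => le_of_eq ?_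
    rw [← ofReal_mul, Complex.norm_exp_ofReal_mul_I]
  have h1 : ∫ x : ℝ, (((1 + x ^ 2)⁻¹ : ℝ) : ℂ) = Real.pi := by
    rw [integral_complex_ofReal, integral_univ_inv_one_add_sq]
  have heq : (fun x : ℝ => (N : ℂ) * (Complex.exp (t * x * I / N) - 1) *
      (((1 + x ^ 2)⁻¹ : ℝ) : ℂ)) = fun x : ℝ => (N : ℂ) * (Complex.exp ((t / N : ℝ) * x * I) *
      (((1 + x ^ 2)⁻¹ : ℝ) : ℂ) - (((1 + x ^ 2)⁻¹ : ℝ) : ℂ)) := by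
    ext x
    rw [show ((t / N : ℝ) * x * I : ℂ) = t * x * I / N by push_cast; ring]
    ring
  rw [heq, integral_const_mul, integral_sub hi' hi, integral_exp_mul_inv_one_add_sq, h1]
  rw [show ((-|t / N| : ℝ) : ℂ) = ((-|t| : ℝ) : ℂ) / N by
    rw [abs_div, Nat.abs_cast]; push_cast; ring]
  ring

lemma mconv_eq_conv (μ ν : Measure ℝ) : mconv μ ν = Measure.conv μ ν := rfl

instance isProbabilityMeasure_mconvPow (μ : Measure ℝ) [IsProbabilityMeasure μ] (N : ℕ) :
    IsProbabilityMeasure (mconvPow μ N) := by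
  induction N with
  | zero => exact Measure.dirac.isProbabilityMeasure
  | succ N ih =>
    rw [mconvPow, mconv_eq_conv]
    infer_instance

instance isProbabilityMeasure_dilate (c : ℝ) (μ : Measure ℝ) [IsProbabilityMeasure μ] :
    IsProbabilityMeasure (dilate c μ) :=
  Measure.isProbabilityMeasure_map (by fun_prop)

lemma charFun_mconvPow (μ : Measure ℝ) [IsProbabilityMeasure μ] (N : ℕ) (t : ℝ) :
    charFun (mconvPow μ N) t = charFun μ t ^ N := by
  induction N with
  | zero => simp [mconvPow, charFun_dirac]
  | succ N ih => rw [mconvPow, mconv_eq_conv, charFun_conv, ih, pow_succ']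

lemma charFun_dilate (c : ℝ) (μ : Measure ℝ) (t : ℝ) :
    charFun (dilate c μ) t = charFun μ (c * t) :=
  charFun_map_mul c t

lemma cauchyMeasure_eq (a : ℝ) {b : ℝ} (hb : 0 < b) :
    cauchyMeasure a b = ProbabilityTheory.cauchyMeasure a b.toNNReal := by
  rw [cauchyMeasure, ProbabilityTheory.cauchyMeasure_of_scale_ne_zero _ (by simpa using hb)]
  congr 1
  ext x
  rw [ProbabilityTheory.cauchyPDF_def, ProbabilityTheory.cauchyPDFReal_def,
    Real.coe_toNNReal _ hb.le]
  congr 1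
  ring

lemma isProbabilityMeasure_cauchyOrDirac (a : ℝ) {b : ℝ} (hb : 0 ≤ b) :
    IsProbabilityMeasure (cauchyOrDirac a b) := by
  rcases hb.eq_or_lt with rfl | hb
  · rw [cauchyOrDirac, if_pos rfl]
    infer_instance
  · rw [cauchyOrDirac, if_neg hb.ne', cauchyMeasure_eq a hb]
    infer_instance

lemma charFun_cauchyMeasure (a : ℝ) {b : ℝ} (hb : 0 < b) (t : ℝ) :
    charFun (cauchyMeasure a b) t = Complex.exp (t * I * a - (b * |t| : ℝ)) := by
  have hpos : ∀ x : ℝ, 0 ≤ (1 / Real.pi) * b / ((x - a) ^ 2 + b ^ 2) := fun x => by positivity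
  rw [charFun_apply_real, cauchyMeasure, integral_withDensity_eq_integral_toReal_smul
    (by fun_prop) (ae_of_all _ fun _ => ENNReal.ofReal_lt_top)]
  simp only [ENNReal.toReal_ofReal (hpos _)]
  rw [← integral_add_right_eq_self _ a]
  have hsub := Measure.integral_comp_mul_left (fun x : ℝ => ((1 / Real.pi) * b /
    ((x + a - a) ^ 2 + b ^ 2)) • Complex.exp (t * ((x + a : ℝ) : ℂ) * I)) b
  rw [abs_of_pos (inv_pos.2 hb)] at hsub
  have hsub' : (∫ x : ℝ, ((1 / Real.pi) * b /
    ((x + a - a) ^ 2 + b ^ 2)) • Complex.exp (t * ((x + a : ℝ) : ℂ) * I)) = b • ∫ x : ℝ,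
      ((1 / Real.pi) * b / ((b * x + a - a) ^ 2 + b ^ 2)) •
        Complex.exp (t * ((b * x + a : ℝ) : ℂ) * I) := by
    rw [hsub, smul_smul, mul_inv_cancel₀ hb.ne', one_smul]
  rw [hsub', ← integral_smul]
  have heq : (fun x : ℝ => b • ((1 / Real.pi) * b / ((b * x + a - a) ^ 2 + b ^ 2)) •
        Complex.exp (t * ((b * x + a : ℝ) : ℂ) * I)) = fun x : ℝ =>
      ((Real.pi : ℂ)⁻¹ * Complex.exp (t * I * a)) *
        (Complex.exp ((b * t : ℝ) * x * I) * (((1 + x ^ 2)⁻¹ : ℝ) : ℂ)) := by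
    ext x
    have hreal : b * ((1 / Real.pi) * b / ((b * x + a - a) ^ 2 + b ^ 2)) =
        Real.pi⁻¹ * (1 + x ^ 2)⁻¹ := by
      rw [show (b * x + a - a) ^ 2 + b ^ 2 = b ^ 2 * (1 + x ^ 2) by ring]
      field_simp
    rw [smul_smul, hreal, real_smul, show (t * ((b * x + a : ℝ) : ℂ) * I) =
      t * I * a + (b * t : ℝ) * x * I by push_cast; ring, Complex.exp_add]
    rw [ofReal_mul, ofReal_inv]
    ring
  rw [heq, integral_const_mul, integral_exp_mul_inv_one_add_sq, sub_eq_add_neg, Complex.exp_add,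
    abs_mul, abs_of_pos hb]
  have : (Real.pi : ℂ) ≠ 0 := by exact_mod_cast Real.pi_ne_zero
  rw [ofReal_neg]
  field_simp

lemma charFun_cauchyOrDirac (a : ℝ) {b : ℝ} (hb : 0 ≤ b) (t : ℝ) :
    charFun (cauchyOrDirac a b) t = Complex.exp (t * I * a - (b * |t| : ℝ)) := by
  rcases hb.eq_or_lt with rfl | hb
  · rw [cauchyOrDirac, if_pos rfl, charFun_dirac]
    congr 1
    simp
    ring
  · rw [cauchyOrDirac, if_neg hb.ne', charFun_cauchyMeasure a hb]

/-- A first-order expansion of the characteristic function at zero yields weak convergence of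
normalised convolution powers to a Cauchy law. -/
lemma tendsto_integral_mconvPow_dilate (μ : Measure ℝ) [IsProbabilityMeasure μ] (a : ℝ) {b : ℝ}
    (hb : 0 ≤ b)
    (h : ∀ t : ℝ, Filter.Tendsto (fun N : ℕ => (N : ℂ) * (charFun μ ((N : ℝ)⁻¹ * t) - 1))
      Filter.atTop (nhds (t * I * a - (b * |t| : ℝ)))) (f : BoundedContinuousFunction ℝ ℝ) :
    Filter.Tendsto (fun N : ℕ => ∫ x, f x ∂(mconvPow (dilate (N : ℝ)⁻¹ μ) N))
      Filter.atTop (nhds (∫ x, f x ∂(cauchyOrDirac a b))) := by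
  have := isProbabilityMeasure_cauchyOrDirac a hb
  have key := ProbabilityMeasure.tendsto_of_tendsto_charFun
    (μ := fun N : ℕ => ⟨mconvPow (dilate (N : ℝ)⁻¹ μ) N, inferInstance⟩)
    (μ₀ := ⟨cauchyOrDirac a b, this⟩) (fun t => by
      simp only [ProbabilityMeasure.coe_mk, charFun_mconvPow, charFun_dilate,
        charFun_cauchyOrDirac a hb]
      simpa using Complex.tendsto_one_add_pow_exp_of_tendsto (h t))
  exact ProbabilityMeasure.tendsto_iff_forall_integral_tendsto.1 key f

lemma measurableSet_le_abs (R : ℝ) : MeasurableSet {x : ℝ | R ≤ |x|} :=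
  measurableSet_le (by fun_prop) (by fun_prop)

lemma integrable_truncated_inv_pow {R : ℝ} (hR : 0 < R) (m : ℕ) :
    Integrable (fun x : ℝ => if R ≤ |x| then (x ^ (m + 2))⁻¹ else 0) ∧
    ∫ x : ℝ, (if R ≤ |x| then (x ^ (m + 2))⁻¹ else 0) =
      (1 + (-1) ^ m) * (R ^ (m + 1))⁻¹ / (m + 1) := by
  have hexp : (-((m + 2 : ℕ) : ℝ)) < -1 := by
    push_cast
    linarith [(Nat.cast_nonneg m : (0 : ℝ) ≤ m)]
  have hpow : Set.EqOn (fun x : ℝ => (x ^ (m + 2))⁻¹) (fun x => x ^ (-((m + 2 : ℕ) : ℝ)))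
      (Set.Ioi R) := fun x hx => by
    simp only
    rw [Real.rpow_neg (hR.trans hx).le, Real.rpow_natCast]
  have hIoi : IntegrableOn (fun x : ℝ => (x ^ (m + 2))⁻¹) (Set.Ioi R) :=
    (integrableOn_congr_fun hpow measurableSet_Ioi).2 (integrableOn_Ioi_rpow_of_lt hexp hR)
  have vIoi : ∫ x in Set.Ioi R, (x ^ (m + 2))⁻¹ = (R ^ (m + 1))⁻¹ / (m + 1) := by
    rw [setIntegral_congr_fun measurableSet_Ioi hpow, integral_Ioi_rpow_of_lt hexp hR,
      show -((m + 2 : ℕ) : ℝ) + 1 = -((m + 1 : ℕ) : ℝ) by push_cast; ring,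
      Real.rpow_neg hR.le, Real.rpow_natCast, neg_div_neg_eq]
    push_cast
    rfl
  have hneg : ∀ x : ℝ, ((-x) ^ (m + 2))⁻¹ = (-1) ^ m * (x ^ (m + 2))⁻¹ := fun x => by
    rw [neg_pow, mul_inv, pow_add, mul_inv, ← inv_pow (-1 : ℝ), inv_neg_one]
    norm_num
  have hIic : IntegrableOn (fun x : ℝ => (x ^ (m + 2))⁻¹) (Set.Iic (-R)) := by
    rw [integrableOn_Iic_iff_integrableOn_Iio]
    have : IntegrableOn (fun x : ℝ => ((-x) ^ (m + 2))⁻¹) (Set.Ioi (- -R)) := by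
      simp only [hneg, neg_neg]
      exact hIoi.const_mul _
    simpa using this.comp_neg_Iio (c := -R)
  have vIic : ∫ x in Set.Iic (-R), (x ^ (m + 2))⁻¹ =
      (-1) ^ m * ((R ^ (m + 1))⁻¹ / (m + 1)) := by
    rw [← integral_comp_neg_Ioi R (fun x : ℝ => (x ^ (m + 2))⁻¹)]
    simp only [hneg]
    rw [integral_const_mul, vIoi]
  have hset : {x : ℝ | R ≤ |x|} = Set.Iic (-R) ∪ Set.Ici R := by
    ext x
    simp only [Set.mem_ofPred_eq, le_abs', Set.mem_union, Set.mem_Iic, Set.mem_Ici]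
  have hfun : (fun x : ℝ => if R ≤ |x| then (x ^ (m + 2))⁻¹ else 0) =
      (Set.Iic (-R) ∪ Set.Ici R).indicator fun x : ℝ => (x ^ (m + 2))⁻¹ := by
    rw [← hset]
    rfl
  have hmeas : MeasurableSet (Set.Iic (-R) ∪ Set.Ici R) := measurableSet_Iic.union measurableSet_Ici
  have hIci := (integrableOn_Ici_iff_integrableOn_Ioi (by simp)).2 hIoi
  refine ⟨?_, ?_⟩
  · rw [hfun, integrable_indicator_iff hmeas]
    exact hIic.union hIci
  · rw [hfun, integral_indicator hmeas, setIntegral_union _ measurableSet_Ici hIic hIci,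
      integral_Ici_eq_integral_Ioi, vIoi, vIic]
    · ring
    · rw [Set.disjoint_left]
      intro x hx hx'
      simp only [Set.mem_Iic, Set.mem_Ici] at hx hx'
      linarith

lemma integral_inv_sub_mul_inv_one_add_sq {R : ℝ} (hR : 0 < R) :
    Integrable (fun x : ℝ => (if R ≤ |x| then x⁻¹ else 0) - x * (1 + x ^ 2)⁻¹) ∧
    ∫ x : ℝ, ((if R ≤ |x| then x⁻¹ else 0) - x * (1 + x ^ 2)⁻¹) = 0 := by
  constructor
  · refine (integrable_inv_one_add_sq.const_mul (R + R⁻¹)).mono' ?_ (ae_of_all _ fun x => ?_)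
    · refine (Measurable.aestronglyMeasurable ?_)
      exact Measurable.sub
        (Measurable.ite (measurableSet_le_abs R) (by fun_prop) (by fun_prop)) (by fun_prop)
    · split_ifs with h
      · have hx : 0 < |x| := hR.trans_le h
        have hx0 : x ≠ 0 := abs_pos.1 hx
        have : x⁻¹ - x * (1 + x ^ 2)⁻¹ = x⁻¹ * (1 + x ^ 2)⁻¹ := by
          field_simp
          ring
        rw [this, norm_mul, norm_inv, Real.norm_eq_abs, Real.norm_of_nonneg (by positivity)]
        gcongr
        have := inv_anti₀ hR h
        linarith
      · rw [zero_sub, norm_neg, norm_mul, Real.norm_eq_abs, Real.norm_of_nonneg (by positivity)]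
        gcongr
        have := inv_pos.2 hR
        linarith
  · have h := integral_neg_eq_self
      (fun x : ℝ => (if R ≤ |x| then x⁻¹ else 0) - x * (1 + x ^ 2)⁻¹) volume
    have h' : (fun x : ℝ => (if R ≤ |-x| then (-x)⁻¹ else 0) - -x * (1 + (-x) ^ 2)⁻¹) =
        fun x : ℝ => -((if R ≤ |x| then x⁻¹ else 0) - x * (1 + x ^ 2)⁻¹) := by
      ext x
      rw [abs_neg, inv_neg]
      split_ifs <;> ring
    rw [h', integral_neg] at h
    linarith

lemma A2.hasSum_arcInt {p : ℝ → ℝ} {a : ℕ → ℝ} {r R : ℝ} (h : A2 p a r R) :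
    HasSum (fun m : ℕ => ((a (m + 3) * ((1 + (-1) ^ m) * (R ^ (m + 1))⁻¹ / (m + 1)) : ℝ) : ℂ))
      (arcInt 0 Real.pi R (fun z => z * pC a z) - I * Real.pi * a 2) := by
  have hR : 0 < R := h.hr.trans h.hrR
  have hRC : (R : ℂ) ≠ 0 := by exact_mod_cast hR.ne'
  have hsum := h.habs R (by rw [abs_of_pos hR]; exact h.hrR)
  rw [abs_of_pos hR] at hsum
  set z : ℝ → ℂ := fun θ => R * Complex.exp (θ * I) with hz
  have hnz : ∀ θ, ‖z θ‖ = R := fun θ => by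
    simp [hz, Complex.norm_exp_ofReal_mul_I, abs_of_pos hR]
  have hz0 : ∀ θ, z θ ≠ 0 := fun θ => by simp [hz, hRC]
  have hzc : Continuous z := by fun_prop
  have hterm : HasSum (fun n : ℕ => ∫ θ in (0 : ℝ)..Real.pi,
      (I * z θ) * (z θ * ((a n : ℂ) / z θ ^ n)))
      (arcInt 0 Real.pi R (fun z => z * pC a z)) := by
    rw [arcInt]
    refine intervalIntegral.hasSum_integral_of_dominated_convergence
      (fun n _ => R ^ 2 * (|a n| / R ^ n)) ?_ ?_ ?_ ?_ ?_
    · intro n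
      refine Continuous.aestronglyMeasurable ?_
      exact (continuous_const.mul hzc).mul (hzc.mul (continuous_const.div (hzc.pow n)
        fun θ => pow_ne_zero _ (hz0 θ)))
    · refine fun n => ae_of_all _ fun θ _ => le_of_eq ?_
      simp only [norm_mul, norm_div, norm_pow, hnz, Complex.norm_I, Complex.norm_real,
        Real.norm_eq_abs]
      ring
    · exact ae_of_all _ fun θ _ => hsum.mul_left _
    · exact intervalIntegrable_const
    · refine ae_of_all _ fun θ _ => ?_
      rw [show I * (R : ℂ) * Complex.exp (θ * I) = I * z θ by rw [hz]; ring]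
      refine HasSum.mul_left _ (HasSum.mul_left _ ?_)
      refine (Summable.of_norm ?_).hasSum
      refine hsum.congr fun n => ?_
      rw [norm_div, norm_pow, hnz, Complex.norm_real, Real.norm_eq_abs]
  have h3 := (hasSum_nat_add_iff' 3).2 hterm
  have hL : ∀ m : ℕ, ∫ θ in (0 : ℝ)..Real.pi, (I * z θ) * (z θ * ((a (m + 3) : ℂ) /
      z θ ^ (m + 3))) = ((a (m + 3) * ((1 + (-1) ^ m) * (R ^ (m + 1))⁻¹ / (m + 1)) : ℝ) : ℂ) := by
    intro m
    have hc : -((m + 1 : ℕ) : ℂ) * I ≠ 0 :=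
      mul_ne_zero (neg_ne_zero.2 (Nat.cast_ne_zero.2 m.succ_ne_zero)) I_ne_zero
    have hval : ∀ θ : ℝ, (I * z θ) * (z θ * ((a (m + 3) : ℂ) / z θ ^ (m + 3))) =
        I * a (m + 3) * ((R : ℂ) ^ (m + 1))⁻¹ * Complex.exp (-((m + 1 : ℕ) : ℂ) * I * θ) := by
      intro θ
      have : Complex.exp (-((m + 1 : ℕ) : ℂ) * I * θ) = (Complex.exp (θ * I) ^ (m + 1))⁻¹ := by
        rw [← Complex.exp_nat_mul, ← Complex.exp_neg]
        congr 1
        ring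
      have hz0' := hz0 θ
      have he := Complex.exp_ne_zero (θ * I)
      rw [this, mul_assoc _ _ (_ ^ (m + 1))⁻¹, ← mul_inv, ← mul_pow]
      change _ = I * a (m + 3) * (z θ ^ (m + 1))⁻¹
      field_simp
      ring
    simp only [hval]
    rw [intervalIntegral.integral_const_mul, integral_exp_mul_complex hc]
    have hpi : Complex.exp (-((m + 1 : ℕ) : ℂ) * I * Real.pi) = (-1) ^ (m + 1) := by
      rw [show -((m + 1 : ℕ) : ℂ) * I * Real.pi = ((m + 1 : ℕ) : ℂ) * -(Real.pi * I) by ring,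
        Complex.exp_nat_mul, Complex.exp_neg, Complex.exp_pi_mul_I]
      norm_num
    rw [hpi]
    have hm : ((m : ℂ) + 1) ≠ 0 := by exact_mod_cast m.succ_ne_zero
    push_cast
    simp only [mul_zero, Complex.exp_zero]
    field_simp
    ring
  have hS : ∑ n ∈ Finset.range 3, ∫ θ in (0 : ℝ)..Real.pi,
      (I * z θ) * (z θ * ((a n : ℂ) / z θ ^ n)) = I * Real.pi * a 2 := by
    have hval : ∀ θ : ℝ, (I * z θ) * (z θ * ((a 2 : ℂ) / z θ ^ 2)) = I * a 2 := fun θ => by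
      have := hz0 θ
      field_simp
    simp only [Finset.sum_range_succ, Finset.sum_range_zero, h.ha0, h.ha1, hval]
    simp
    ring
  rw [hS, funext hL] at h3
  exact h3

/-- The density of `tailMeasure p R`. -/
noncomputable def tailDensity (p : ℝ → ℝ) (R x : ℝ) : ℝ := if R ≤ |x| then p x else 0

namespace A2

variable {p : ℝ → ℝ} {a : ℕ → ℝ} {r R : ℝ}

lemma tailDensity_nonneg (h : A2 p a r R) (x : ℝ) : 0 ≤ tailDensity p R x := by
  unfold tailDensity
  split_ifs with hx
  exacts [h.hpos x hx, le_rfl]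

lemma measurable_tailDensity (h : A2 p a r R) : Measurable (tailDensity p R) := by
  refine measurable_of_tendsto_metrizable
    (f := fun N x => ∑ n ∈ Finset.range N, if R ≤ |x| then a n / x ^ n else 0) (fun N => ?_)
    (tendsto_pi_nhds.2 fun x => ?_)
  · refine Finset.measurable_fun_sum _ fun n _ => ?_
    exact Measurable.ite (measurableSet_le_abs R) (by fun_prop) measurable_const
  · unfold tailDensity
    by_cases hx : R ≤ |x|
    · simpa [hx] using (h.hsum x (h.hrR.trans_le hx)).tendsto_sum_nat
    · simp [hx]

lemma tailMeasure_eq_withDensity (p : ℝ → ℝ) (R : ℝ) :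
    tailMeasure p R = volume.withDensity fun x => ENNReal.ofReal (tailDensity p R x) := rfl

lemma integrable_tailDensity (h : A2 p a r R) [IsFiniteMeasure (tailMeasure p R)] :
    Integrable (tailDensity p R) := by
  refine ⟨h.measurable_tailDensity.aestronglyMeasurable, ?_⟩
  rw [hasFiniteIntegral_iff_ofReal (ae_of_all _ h.tailDensity_nonneg)]
  have := measure_lt_top (tailMeasure p R) Set.univ
  rwa [tailMeasure_eq_withDensity, withDensity_apply _ MeasurableSet.univ,
    Measure.restrict_univ] at this

lemma hasSum_mul_tailDensity_sub (h : A2 p a r R) (x : ℝ) :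
    HasSum (fun m : ℕ => a (m + 3) * if R ≤ |x| then (x ^ (m + 2))⁻¹ else 0)
      (x * tailDensity p R x - a 2 * if R ≤ |x| then x⁻¹ else 0) := by
  unfold tailDensity
  by_cases hx : R ≤ |x|
  · have hx0 : x ≠ 0 := abs_pos.1 ((h.hr.trans h.hrR).trans_le hx)
    simp only [hx, if_true]
    have h3 := (hasSum_nat_add_iff' 3).2 ((h.hsum x (h.hrR.trans_le hx)).mul_left x)
    have hS : ∑ n ∈ Finset.range 3, x * (a n / x ^ n) = a 2 * x⁻¹ := by
      simp only [Finset.sum_range_succ, Finset.sum_range_zero, h.ha0, h.ha1]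
      field_simp
      ring
    have hL : ∀ m : ℕ, x * (a (m + 3) / x ^ (m + 3)) = a (m + 3) * (x ^ (m + 2))⁻¹ := fun m => by
      field_simp
      ring
    rw [hS, funext hL] at h3
    exact h3
  · simp [hx, hasSum_zero]

/-- The principal-value first moment of the tail is the part of the contour integral
coming from all terms but the leading one. -/
lemma integral_mul_tailDensity_sub (h : A2 p a r R) :
    Integrable (fun x => x * tailDensity p R x - a 2 * if R ≤ |x| then x⁻¹ else 0) ∧
    ((∫ x, (x * tailDensity p R x - a 2 * if R ≤ |x| then x⁻¹ else 0) : ℝ) : ℂ) =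
      arcInt 0 Real.pi R (fun z => z * pC a z) - I * Real.pi * a 2 := by
  have hR : 0 < R := h.hr.trans h.hrR
  have hsum := h.habs R (by rw [abs_of_pos hR]; exact h.hrR)
  rw [abs_of_pos hR] at hsum
  have hsum3 : Summable fun m : ℕ => |a (m + 3)| * (R ^ m)⁻¹ := by
    refine (((summable_nat_add_iff 3).2 hsum).mul_left (R ^ 3)).congr fun m => ?_
    field_simp
    ring
  have hbound : ∀ (m : ℕ) (x : ℝ), ‖a (m + 3) * if R ≤ |x| then (x ^ (m + 2))⁻¹ else 0‖ ≤
      |a (m + 3)| * (R ^ m)⁻¹ * if R ≤ |x| then (x ^ (0 + 2))⁻¹ else 0 := by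
    intro m x
    split_ifs with hx
    · rw [norm_mul, Real.norm_eq_abs, norm_inv, norm_pow, Real.norm_eq_abs, mul_assoc, pow_add,
        mul_inv, sq_abs, zero_add]
      gcongr
    · simp
  have hg := (integrable_truncated_inv_pow hR 0).1.const_mul (∑' m : ℕ, |a (m + 3)| * (R ^ m)⁻¹)
  refine ⟨?_, ?_⟩
  · refine hg.mono' ?_ (ae_of_all _ fun x => ?_)
    · refine Measurable.aestronglyMeasurable ?_
      refine (measurable_id.mul h.measurable_tailDensity).sub (Measurable.const_mul ?_ _)
      exact Measurable.ite (measurableSet_le_abs R) (by fun_prop) measurable_const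
    · rw [← (h.hasSum_mul_tailDensity_sub x).tsum_eq]
      exact tsum_of_norm_bounded (hsum3.hasSum.mul_right _) fun m => hbound m x
  · have hs := hasSum_integral_of_dominated_convergence (μ := volume)
      (F := fun (m : ℕ) (x : ℝ) => a (m + 3) * if R ≤ |x| then (x ^ (m + 2))⁻¹ else 0)
      (fun m x => |a (m + 3)| * (R ^ m)⁻¹ * if R ≤ |x| then (x ^ (0 + 2))⁻¹ else 0)
      (fun m => ((integrable_truncated_inv_pow hR m).1.const_mul _).aestronglyMeasurable)
      (fun m => ae_of_all _ (hbound m))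
      (ae_of_all _ fun x => hsum3.mul_right _)
      (by simpa only [tsum_mul_right] using hg)
      (ae_of_all _ h.hasSum_mul_tailDensity_sub)
    simp only [integral_const_mul, (integrable_truncated_inv_pow hR _).2] at hs
    exact (hasSum_ofReal.2 hs).unique h.hasSum_arcInt

/-- After subtracting a multiple of the Cauchy density, the tail has a finite first moment. -/
lemma integral_mul_tailDensity_sub_cauchy (h : A2 p a r R) :
    Integrable (fun x => x * (tailDensity p R x - a 2 * (1 + x ^ 2)⁻¹)) ∧
    ((∫ x, x * (tailDensity p R x - a 2 * (1 + x ^ 2)⁻¹) : ℝ) : ℂ) =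
      arcInt 0 Real.pi R (fun z => z * pC a z) - I * Real.pi * a 2 := by
  have hR : 0 < R := h.hr.trans h.hrR
  obtain ⟨i1, v1⟩ := h.integral_mul_tailDensity_sub
  obtain ⟨i2, v2⟩ := integral_inv_sub_mul_inv_one_add_sq hR
  have heq : (fun x => x * (tailDensity p R x - a 2 * (1 + x ^ 2)⁻¹)) = fun x =>
      (x * tailDensity p R x - a 2 * if R ≤ |x| then x⁻¹ else 0) +
        a 2 * ((if R ≤ |x| then x⁻¹ else 0) - x * (1 + x ^ 2)⁻¹) := by
    ext x
    ring
  rw [heq]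
  refine ⟨i1.add (i2.const_mul _), ?_⟩
  rw [integral_add i1 (i2.const_mul _), integral_const_mul, v2, mul_zero, add_zero, v1]

lemma tendsto_integral_tailMeasure (h : A2 p a r R) [IsFiniteMeasure (tailMeasure p R)] (t : ℝ) :
    Filter.Tendsto (fun N : ℕ => ∫ x : ℝ, (N : ℂ) * (Complex.exp (t * x * I / N) - 1)
      ∂(tailMeasure p R)) Filter.atTop
      (nhds (t * I * (∫ x, x * (tailDensity p R x - a 2 * (1 + x ^ 2)⁻¹) : ℝ) +
        a 2 * -(Real.pi * |t| : ℝ))) := by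
  have hd := h.integrable_tailDensity
  have hx := h.integral_mul_tailDensity_sub_cauchy.1
  have hi := integrable_inv_one_add_sq
  have hh : Integrable fun x => tailDensity p R x - a 2 * (1 + x ^ 2)⁻¹ := hd.sub (hi.const_mul _)
  have l1 := tendsto_integral_nat_mul_exp_div_sub_one (m := volume)
    (h := fun x => ((tailDensity p R x - a 2 * (1 + x ^ 2)⁻¹ : ℝ) : ℂ)) hh.ofReal.aestronglyMeasurable
    (by simpa using hx.ofReal (𝕜 := ℂ)) t
  have l2 := (tendsto_integral_nat_mul_exp_div_sub_one_inv_one_add_sq t).const_mul (a 2 : ℂ)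
  have hv : ∫ x : ℝ, (x : ℂ) * ((tailDensity p R x - a 2 * (1 + x ^ 2)⁻¹ : ℝ) : ℂ) =
      ((∫ x, x * (tailDensity p R x - a 2 * (1 + x ^ 2)⁻¹) : ℝ) : ℂ) := by
    rw [← integral_complex_ofReal]
    simp only [ofReal_mul]
  rw [← hv]
  refine (l1.add l2).congr fun N => ?_
  have hbdd : ∀ x : ℝ, ‖(N : ℂ) * (Complex.exp (t * x * I / N) - 1)‖ ≤ N * 2 := fun x => by
    rw [norm_mul, Complex.norm_natCast]
    refine mul_le_mul_of_nonneg_left ((norm_sub_le _ _).trans (le_of_eq ?_)) (Nat.cast_nonneg _)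
    rw [show (t * x * I / N : ℂ) = ((t * x / N : ℝ) : ℂ) * I by push_cast; ring,
      Complex.norm_exp_ofReal_mul_I, norm_one]
    norm_num
  have hcont : AEStronglyMeasurable
      (fun x : ℝ => (N : ℂ) * (Complex.exp (t * x * I / N) - 1)) volume :=
    Continuous.aestronglyMeasurable (by fun_prop)
  have i1 : Integrable fun x : ℝ => (N : ℂ) * (Complex.exp (t * x * I / N) - 1) *
      ((tailDensity p R x - a 2 * (1 + x ^ 2)⁻¹ : ℝ) : ℂ) :=
    hh.ofReal.bdd_mul hcont (ae_of_all _ hbdd)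
  have i2 : Integrable fun x : ℝ => (a 2 : ℂ) * ((N : ℂ) * (Complex.exp (t * x * I / N) - 1) *
      (((1 + x ^ 2)⁻¹ : ℝ) : ℂ)) :=
    (hi.ofReal.bdd_mul hcont (ae_of_all _ hbdd)).const_mul _
  rw [tailMeasure_eq_withDensity, integral_withDensity_eq_integral_toReal_smul
    h.measurable_tailDensity.ennreal_ofReal (ae_of_all _ fun _ => ENNReal.ofReal_lt_top),
    ← integral_const_mul, ← integral_add i1 i2]
  refine integral_congr_ae (ae_of_all _ fun x => ?_)
  simp only [ENNReal.toReal_ofReal (h.tailDensity_nonneg x), real_smul]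
  push_cast
  ring

end A2

lemma integrable_exp_mul_I_div (m : Measure ℝ) [IsFiniteMeasure m] (N : ℕ) (t : ℝ) :
    Integrable (fun x : ℝ => Complex.exp (t * x * I / N)) m := by
  refine (integrable_const (1 : ℝ)).mono' (Continuous.aestronglyMeasurable (by fun_prop))
    (ae_of_all _ fun x => le_of_eq ?_)
  rw [show (t * x * I / N : ℂ) = ((t * x / N : ℝ) : ℂ) * I by push_cast; ring,
    Complex.norm_exp_ofReal_mul_I]

lemma integrable_nat_mul_exp_div_sub_one (m : Measure ℝ) [IsFiniteMeasure m] (N : ℕ) (t : ℝ) :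
    Integrable (fun x : ℝ => (N : ℂ) * (Complex.exp (t * x * I / N) - 1)) m :=
  ((integrable_exp_mul_I_div m N t).sub (integrable_const _)).const_mul _

lemma nat_mul_charFun_sub_one (μ : Measure ℝ) [IsProbabilityMeasure μ] (N : ℕ) (t : ℝ) :
    (N : ℂ) * (charFun μ ((N : ℝ)⁻¹ * t) - 1) =
      ∫ x : ℝ, (N : ℂ) * (Complex.exp (t * x * I / N) - 1) ∂μ := by
  rw [integral_const_mul, integral_sub (integrable_exp_mul_I_div μ N t) (integrable_const _),
    charFun_apply_real]
  simp only [integral_const, probReal_univ, one_smul]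
  congr 3
  ext x
  congr 1
  push_cast
  ring

/-- Theorem 3.1 (tensor case): for `μ = ν + λ ∈ P₂` with complex first moment
`m₁(μ) = a + bi`, the measures `(D_{1/N} μ)^{∗N}` converge weakly to `μ_{a,b}`. -/
theorem clt_cauchy_classical
    (ν : Measure ℝ) [IsFiniteMeasure ν]
    (hν2 : Integrable (fun x : ℝ => x ^ 2) ν)
    (p : ℝ → ℝ) (aseq : ℕ → ℝ) (r R : ℝ) (hA2 : A2 p aseq r R)
    (μ : Measure ℝ) (hμ : μ = ν + tailMeasure p R) (hprob : IsProbabilityMeasure μ)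
    (a b : ℝ) (hb : 0 ≤ b)
    (hm1 : (∫ x, x ∂ν : ℝ) + arcInt 0 Real.pi R (fun z => z * pC aseq z) =
      a + Complex.I * b) :
    ∀ f : BoundedContinuousFunction ℝ ℝ,
      Filter.Tendsto (fun N : ℕ => ∫ x, f x ∂(mconvPow (dilate (N : ℝ)⁻¹ μ) N))
        Filter.atTop (nhds (∫ x, f x ∂(cauchyOrDirac a b))) := by
  have hfin : IsFiniteMeasure (tailMeasure p R) :=
    isFiniteMeasure_of_le μ (hμ ▸ Measure.le_add_left le_rfl)
  have hν1 : Integrable (fun x : ℝ => x) ν := by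
    refine (hν2.add (integrable_const (1 : ℝ))).mono' (by fun_prop) (ae_of_all _ fun x => ?_)
    simp only [Real.norm_eq_abs, Pi.add_apply]
    nlinarith [sq_nonneg (|x| - 1), sq_abs x]
  have hv := hA2.integral_mul_tailDensity_sub_cauchy.2
  set J : ℝ := ∫ x, x * (tailDensity p R x - aseq 2 * (1 + x ^ 2)⁻¹) with hJ
  have harc : arcInt 0 Real.pi R (fun z => z * pC aseq z) = J + I * Real.pi * aseq 2 := by
    rw [hv]
    ring
  rw [harc] at hm1
  have hre : ∫ x, x ∂ν + J = a := by simpa using congrArg Complex.re hm1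
  have him : Real.pi * aseq 2 = b := by simpa using congrArg Complex.im hm1
  refine tendsto_integral_mconvPow_dilate μ a hb fun t => ?_
  have l1 := tendsto_integral_nat_mul_exp_div_sub_one (m := ν) (h := fun _ => 1)
    aestronglyMeasurable_const (by simpa using hν1.ofReal (𝕜 := ℂ)) t
  have hmean : ∫ x : ℝ, (x : ℂ) ∂ν = ((∫ x, x ∂ν : ℝ) : ℂ) := integral_complex_ofReal
  simp only [mul_one, hmean] at l1
  have l2 := l1.add (hA2.tendsto_integral_tailMeasure t)
  rw [← hJ] at l2
  have hlim : t * I * (∫ x, x ∂ν : ℝ) + (t * I * J + aseq 2 * -(Real.pi * |t| : ℝ)) =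
      t * I * a - (b * |t| : ℝ) := by
    rw [← hre, ← him]
    push_cast
    ring
  rw [hlim] at l2
  refine l2.congr fun N => ?_
  rw [nat_mul_charFun_sub_one, hμ, integral_add_measure
    (integrable_nat_mul_exp_div_sub_one ν N t)
    (integrable_nat_mul_exp_div_sub_one (tailMeasure p R) N t)]
end
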